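/- arXiv:1903.06210 — 3 statements merged into one kernel-verified Lean document; each statement's English description precedes it below -/
import Mathlib

section
/- For all integers τ ≥ 1 and 2 ≤ d ≤ c ≤ τ+1, and every prime power q ≥ τ+1, there exists a convolutional code over the finite field with q² elements with k = τ-d+2 and n = τ-d+c+1 whose column distance at delay τ is at least d and whose column span at delay τ is at least c; its rate k/n = (τ-d+2)/(τ-d+c+1) is the maximum possible rate of any convolutional code with column distance d and column span c at delay τ. -/
/-- The output stream of a rate-`k/n` convolutional code with memory `m` specified
by matrices `G 0, …, G m`: on input stream `s : ℕ → F^k` (with `s t = 0` understood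
for `t < 0`), the coded packet at time `t` is `x(t) = ∑_{i=0}^{m} s(t-i) · G i`. -/
def convOutput {F : Type*} [Field F] {k n : ℕ} (m : ℕ)
    (G : Fin (m + 1) → Matrix (Fin k) (Fin n) F)
    (s : ℕ → Fin k → F) (t : ℕ) : Fin n → F :=
  ∑ i : Fin (m + 1), if (i : ℕ) ≤ t then Matrix.vecMul (s (t - (i : ℕ))) (G i) else 0

/-- A convolutional code has column distance at least `d` and column span at least
`c` at delay `τ` if every input stream with `s 0 ≠ 0` produces at least `d` nonzero
coded packets among `x(0), …, x(τ)`, whose nonzero positions span an interval of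
length at least `c`. -/
def HasColDistSpan {F : Type*} [Field F] {k n : ℕ} (m : ℕ)
    (G : Fin (m + 1) → Matrix (Fin k) (Fin n) F) (τ d c : ℕ) : Prop :=
  ∀ s : ℕ → Fin k → F, s 0 ≠ 0 →
    d ≤ {i : ℕ | i ≤ τ ∧ convOutput m G s i ≠ 0}.ncard ∧
    ∃ i j : ℕ, i ≤ τ ∧ j ≤ τ ∧ convOutput m G s i ≠ 0 ∧ convOutput m G s j ≠ 0 ∧
      c ≤ j - i + 1


open Finset Polynomial

theorem exists_parity_row {F : Type*} [Field F] (k B : ℕ)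
    (Φ : (ℕ → F) →ₗ[F] (Fin B → F))
    (hinj : ∀ v : ℕ → F, (∀ j, v j ≠ 0 → k ≤ j ∧ j < k + B) → Φ v = 0 → v = 0)
    (l : ℕ) :
    ∃ p : ℕ → F, Φ p = 0 ∧ (∀ j < k, p j = if j = l then 1 else 0) ∧
      (l < k → ∀ j, k + B ≤ j → p j = 0) := by
  let e : (Fin B → F) →ₗ[F] (ℕ → F) :=
    { toFun := fun y j => if h : k ≤ j ∧ j < k + B then y ⟨j - k, by omega⟩ else 0
      map_add' := by
        intro x y; ext j
        by_cases h : k ≤ j ∧ j < k + B <;> simp [h]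
      map_smul' := by
        intro x y; ext j
        by_cases h : k ≤ j ∧ j < k + B <;> simp [h] }
  have he : ∀ y j, e y j = if h : k ≤ j ∧ j < k + B then y ⟨j - k, by omega⟩ else 0 :=
    fun _ _ => rfl
  have hker : Function.Injective (Φ ∘ₗ e) := by
    rw [← LinearMap.ker_eq_bot, LinearMap.ker_eq_bot']
    intro y hy
    have h0 : e y = 0 := by
      refine hinj _ (fun j hj => ?_) hy
      by_contra h
      exact hj (by rw [he, dif_neg h])
    ext r
    have := congrFun h0 (k + r)
    rw [he, dif_pos (by omega)] at this
    simpa using this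
  obtain ⟨y, hy⟩ := LinearMap.injective_iff_surjective.1 hker (-Φ (Pi.single l 1))
  refine ⟨Pi.single l 1 + e y, ?_, fun j hj => ?_, fun hl j hj => ?_⟩
  · rw [map_add, ← LinearMap.comp_apply, hy, add_neg_cancel]
  · rw [Pi.add_apply, he, dif_neg (by omega), add_zero, Pi.single_apply]
  · rw [Pi.add_apply, he, dif_neg (by omega), add_zero, Pi.single_apply, if_neg (by omega)]

/-- Diagonal embedding: a block code given by a parity check `Φ` all of whose symbols can be
recovered within delay `τ` yields a convolutional code. -/
theorem exists_hasColDistSpan_of_parity {F : Type*} [Field F] (τ d c k B : ℕ)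
    (Φ : (ℕ → F) →ₗ[F] (Fin B → F))
    (hinj : ∀ v : ℕ → F, (∀ j, v j ≠ 0 → k ≤ j ∧ j < k + B) → Φ v = 0 → v = 0)
    (hmain : ∀ i < k, ∀ v : ℕ → F, (∀ j < i, v j = 0) → v i ≠ 0 →
      (∀ j, k + B ≤ j → v j = 0) → Φ v = 0 →
      d ≤ {j | j ∈ Icc i (i + τ) ∧ v j ≠ 0}.ncard ∧
        ∃ j, i + (c - 1) ≤ j ∧ j ≤ i + τ ∧ v j ≠ 0) :
    ∃ (m : ℕ) (G : Fin (m + 1) → Matrix (Fin k) (Fin (k + B)) F),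
      HasColDistSpan m G τ d c := by
  choose P hP0 hP1 hP2 using exists_parity_row k B Φ hinj
  refine ⟨k + B, fun i l j => if (j : ℕ) = l + i then P l j else 0, fun s hs => ?_⟩
  obtain ⟨i, hi⟩ := Function.ne_iff.1 hs
  set G : Fin (k + B + 1) → Matrix (Fin k) (Fin (k + B)) F :=
    fun i l j => if (j : ℕ) = l + i then P l j else 0 with hG
  let v : ℕ → F := ∑ l : Fin k, (if i ≤ l then s (l - i) l else 0) • P l
  have hv : ∀ j, v j = ∑ l : Fin k, (if i ≤ l then s (l - i) l else 0) * P l j := by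
    intro j; simp only [v, Finset.sum_apply, Pi.smul_apply, smul_eq_mul]
  have hPz : ∀ l j : ℕ, j < k → j ≠ l → P l j = 0 := by
    intro l j hj hl
    rw [hP1 l j hj, if_neg hl]
  have hvi : v i ≠ 0 := by
    rw [hv, Finset.sum_eq_single i]
    · simpa [hP1 i i i.2] using hi
    · intro l _ hl
      rw [hPz l i i.2 (fun h => hl (Fin.ext h.symm)), mul_zero]
    · simp
  have hconv : ∀ t (h : i + t < k + B),
      convOutput (k + B) G s t ⟨i + t, h⟩ = v (i + t) := by
    intro t h
    rw [hv, convOutput, Finset.sum_apply]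
    have : ∀ r : Fin (k + B + 1),
        (if (r : ℕ) ≤ t then Matrix.vecMul (s (t - r)) (G r) else 0) ⟨i + t, h⟩ =
        ∑ l : Fin k, if (r : ℕ) ≤ t ∧ i + t = l + r then s (t - r) l * P l (i + t) else 0 := by
      intro r
      by_cases hr : (r : ℕ) ≤ t
      · simp [hr, Matrix.vecMul, dotProduct, hG]
      · simp [hr]
    simp_rw [this]
    rw [Finset.sum_comm]
    refine Finset.sum_congr rfl fun l _ => ?_
    by_cases hl : (l : ℕ) ≤ i + t
    · rw [Finset.sum_eq_single ⟨i + t - l, by omega⟩]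
      · by_cases hil : i ≤ l
        · have hil' : (i : ℕ) ≤ l := hil
          rw [if_pos hil, if_pos (by constructor <;> dsimp only <;> omega)]
          dsimp only
          rw [show t - ((i : ℕ) + t - l) = l - i by omega]
        · have hil' : ¬ (i : ℕ) ≤ l := hil
          rw [if_neg hil, if_neg (by omega), zero_mul]
      · intro r _ hr
        rw [if_neg]
        rintro ⟨h1, h2⟩
        exact hr (Fin.ext (by dsimp only; omega))
      · simp
    · rw [hPz l (i + t) (by omega) (by omega), mul_zero]
      refine Finset.sum_eq_zero fun r _ => ?_
      simp
  obtain ⟨h1, j, hj1, hj2, hj3⟩ := hmain i i.2 v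
    (by
      intro j hj
      rw [hv]
      refine Finset.sum_eq_zero fun l _ => ?_
      by_cases hil : i ≤ l
      · have hil' : (i : ℕ) ≤ l := hil
        rw [hPz l j (by omega) (by omega), mul_zero]
      · rw [if_neg hil, zero_mul])
    hvi
    (by
      intro j hj
      rw [hv]
      exact Finset.sum_eq_zero fun l _ => by rw [hP2 l l.2 j hj, mul_zero])
    (by simp only [v, map_sum, map_smul, hP0, smul_zero, Finset.sum_const_zero])
  have hne : ∀ t, v (i + t) ≠ 0 → convOutput (k + B) G s t ≠ 0 := by
    intro t ht h
    have hlt : i + t < k + B := by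
      by_contra hcon
      refine ht ?_
      rw [hv]
      exact Finset.sum_eq_zero fun l _ => by rw [hP2 l l.2 _ (by omega), mul_zero]
    exact ht (by rw [← hconv t hlt, h]; rfl)
  constructor
  · refine h1.trans (Set.ncard_le_ncard_of_injOn (fun j => j - i) ?_ ?_ ?_)
    · rintro j ⟨hj, hj'⟩
      rw [Finset.mem_Icc] at hj
      refine ⟨by omega, hne _ ?_⟩
      rwa [Nat.add_sub_cancel' hj.1]
    · rintro j ⟨hj, -⟩ j' ⟨hj', -⟩ (h : j - i = j' - i)
      rw [Finset.mem_Icc] at hj hj'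
      omega
    · exact (Set.finite_Iic τ).subset fun x hx => hx.1
  · refine ⟨0, j - i, by omega, by omega, hne 0 (by simpa using hvi), hne _ ?_, by omega⟩
    rwa [Nat.add_sub_cancel' (by omega)]

/-- A vector-valued Vandermonde argument. -/
theorem sum_eval_smul_eq_zero {K V : Type*} [Field K] [AddCommGroup V] [Module K V]
    (S : Finset ℕ) (b : ℕ → K) (u : ℕ → V) (N : ℕ)
    (h : ∀ l < N, ∑ j ∈ S, b j ^ l • u j = 0) (p : K[X]) (hp : p.natDegree < N) :
    ∑ j ∈ S, p.eval (b j) • u j = 0 := by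
  simp_rw [eval_eq_sum_range' hp, Finset.sum_smul]
  rw [Finset.sum_comm]
  refine Finset.sum_eq_zero fun l hl => ?_
  simp_rw [mul_smul, ← Finset.smul_sum]
  rw [h l (Finset.mem_range.1 hl), smul_zero]

theorem eq_zero_of_sum_eval_smul {K V : Type*} [Field K] [AddCommGroup V] [Module K V]
    (S : Finset ℕ) (b : ℕ → K) (hb : Set.InjOn b S) (u : ℕ → V)
    (h : ∀ p : K[X], p.natDegree < #S → ∑ j ∈ S, p.eval (b j) • u j = 0) :
    ∀ j ∈ S, u j = 0 := by
  intro i hi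
  have h1 := h (∏ j ∈ S.erase i, (X - C (b j))) (by
    rw [natDegree_finsetProd_X_sub_C_eq_card, Finset.card_erase_of_mem hi]
    have := Finset.card_pos.2 ⟨i, hi⟩
    omega)
  rw [Finset.sum_eq_single_of_mem i hi] at h1
  · refine (smul_eq_zero.1 h1).resolve_left ?_
    rw [eval_prod, ← ne_eq, Finset.prod_ne_zero_iff]
    intro j hj
    rw [Finset.mem_erase] at hj
    rw [eval_sub, eval_X, eval_C, sub_ne_zero]
    exact fun h' => hj.1 (hb hj.2 hi h'.symm)
  · intro j hj hji
    rw [eval_prod, Finset.prod_eq_zero (Finset.mem_erase.2 ⟨hji, hj⟩) (by simp), zero_smul]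

theorem eq_zero_of_sum_pow_smul {K V : Type*} [Field K] [AddCommGroup V] [Module K V]
    (S : Finset ℕ) (b : ℕ → K) (hb : Set.InjOn b S) (u : ℕ → V)
    (h : ∀ l < #S, ∑ j ∈ S, b j ^ l • u j = 0) :
    ∀ j ∈ S, u j = 0 :=
  eq_zero_of_sum_eval_smul S b hb u (sum_eval_smul_eq_zero S b u _ h)

/-- A solution of a square Vandermonde system over `K` lies in `K`. -/
theorem mem_one_of_sum_pow_smul {K F : Type*} [Field K] [Field F] [Algebra K F]
    (S : Finset ℕ) (b : ℕ → K) (hb : Set.InjOn b S) (u : ℕ → F)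
    (h : ∀ l < #S, ∑ j ∈ S, b j ^ l • u j ∈ (1 : Submodule K F)) :
    ∀ j ∈ S, u j ∈ (1 : Submodule K F) := by
  intro j hj
  rw [← Submodule.Quotient.mk_eq_zero, ← Submodule.mkQ_apply]
  refine eq_zero_of_sum_pow_smul S b hb (fun j => (1 : Submodule K F).mkQ (u j)) ?_ j hj
  intro l hl
  rw [← (Submodule.Quotient.mk_eq_zero _).2 (h l hl), ← Submodule.mkQ_apply, map_sum]
  simp only [map_smul]

theorem convOutput_shift {F : Type*} [Field F] {k n : ℕ} (m : ℕ)
    (G : Fin (m + 1) → Matrix (Fin k) (Fin n) F) (s : ℕ → Fin k → F) (t u : ℕ)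
    (h : ∀ t' < t, s t' = 0) :
    convOutput m G (fun u => s (t + u)) u = convOutput m G s (t + u) := by
  unfold convOutput
  refine Finset.sum_congr rfl fun i _ => ?_
  by_cases hi : (i : ℕ) ≤ u
  · rw [if_pos hi, if_pos (by omega), Nat.add_sub_assoc hi]
  · rw [if_neg hi]
    by_cases hi' : (i : ℕ) ≤ t + u
    · rw [if_pos hi', h _ (by omega), Matrix.zero_vecMul]
    · rw [if_neg hi']

/-- Under the periodic erasure of `δ + N` packets out of every `τ + 1 + δ`, the input stream
is determined within delay `τ`. -/
theorem eq_zero_of_periodic_erasure {F : Type*} [Field F] {k n m τ δ N : ℕ}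
    (hN : 1 ≤ N) (hB : δ + N ≤ τ) (G : Fin (m + 1) → Matrix (Fin k) (Fin n) F)
    (hG : HasColDistSpan m G τ (N + 1) (δ + N + 1)) (s : ℕ → Fin k → F) (T : ℕ)
    (h : ∀ t < T + τ, δ + N ≤ t % (τ + 1 + δ) → convOutput m G s t = 0) :
    ∀ t < T, s t = 0 := by
  intro t
  induction t using Nat.strong_induction_on with
  | _ t ih =>
  intro htT
  by_contra hst
  obtain ⟨h1, i, j, hi, hj, hi0, hj0, hij⟩ := hG (fun u => s (t + u)) (by simpa using hst)
  have key : ∀ u, u ≤ τ → convOutput m G (fun u => s (t + u)) u ≠ 0 →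
      (t + u) % (τ + 1 + δ) < δ + N := by
    intro u hu h0
    by_contra hcon
    rw [convOutput_shift m G s t u (fun t' ht' => ih t' ht' (by omega))] at h0
    exact h0 (h _ (by omega) (by omega))
  have hmod : ∀ u, (t + u) % (τ + 1 + δ) = (t % (τ + 1 + δ) + u) % (τ + 1 + δ) := by
    intro u; simp
  simp_rw [hmod] at key
  have hρ : t % (τ + 1 + δ) < τ + 1 + δ := Nat.mod_lt _ (by omega)
  generalize t % (τ + 1 + δ) = ρ at key hρ
  have key' : ∀ u, u ≤ τ → convOutput m G (fun u => s (t + u)) u ≠ 0 →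
      (ρ + u < δ + N) ∨ (τ + 1 + δ ≤ ρ + u ∧ ρ + u < τ + 1 + δ + (δ + N)) := by
    intro u hu h0
    have := key u hu h0
    rcases lt_or_ge (ρ + u) (τ + 1 + δ) with hl | hl
    · rw [Nat.mod_eq_of_lt hl] at this; exact Or.inl this
    · rw [Nat.mod_eq_sub_mod hl, Nat.mod_eq_of_lt (by omega)] at this
      right; omega
  by_cases hc : δ < ρ ∧ ρ < δ + N
  · have hsub : {i : ℕ | i ≤ τ ∧ convOutput m G (fun u => s (t + u)) i ≠ 0} ⊆
        ((Finset.range (δ + N - ρ) ∪ Finset.Icc (τ + 1 + δ - ρ) τ : Finset ℕ) : Set ℕ) := by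
      rintro u ⟨hu, hu0⟩
      have := key' u hu hu0
      simp only [Finset.coe_union, Set.mem_union, Finset.mem_coe, Finset.mem_range,
        Finset.mem_Icc]
      omega
    have h2 := Set.ncard_le_ncard hsub (Finset.finite_toSet _)
    rw [Set.ncard_coe_finset] at h2
    have h3 := Finset.card_union_le (Finset.range (δ + N - ρ)) (Finset.Icc (τ + 1 + δ - ρ) τ)
    rw [Finset.card_range, Nat.card_Icc] at h3
    omega
  · have hki := key' i hi hi0
    have hkj := key' j hj hj0
    omega

theorem card_filter_mod_le (B k τ L : ℕ) :
    #{t ∈ range (L * (k + B) + τ) | B ≤ t % (k + B)} ≤ L * k + τ := by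
  induction L with
  | zero =>
    refine (Finset.card_filter_le _ _).trans ?_
    simp
  | succ L ih =>
    have h1 : {t ∈ range ((L + 1) * (k + B) + τ) | B ≤ t % (k + B)} ⊆
        (Ico B (k + B)) ∪ ({t ∈ range (L * (k + B) + τ) | B ≤ t % (k + B)}).image
          (· + (k + B)) := by
      intro t ht
      rw [Finset.mem_filter, Finset.mem_range] at ht
      rw [Finset.mem_union]
      rcases lt_or_ge t (k + B) with h | h
      · left
        rw [Nat.mod_eq_of_lt h] at ht
        rw [Finset.mem_Ico]; omega
      · right
        rw [Finset.mem_image]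
        refine ⟨t - (k + B), ?_, by omega⟩
        rw [Finset.mem_filter, Finset.mem_range, ← Nat.mod_eq_sub_mod h]
        refine ⟨?_, ht.2⟩
        have : (L + 1) * (k + B) = L * (k + B) + (k + B) := by ring
        omega
    have h2 := Finset.card_le_card h1
    have h3 := Finset.card_union_le (Ico B (k + B))
      (({t ∈ range (L * (k + B) + τ) | B ≤ t % (k + B)}).image (· + (k + B)))
    have h4 := Finset.card_image_le (s := {t ∈ range (L * (k + B) + τ) | B ≤ t % (k + B)})
      (f := (· + (k + B)))
    rw [Nat.card_Ico] at h3
    have : (L + 1) * k = L * k + k := by ring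
    omega

/-- The rate bound, by dimension counting under a periodic erasure. -/
theorem rate_le {F : Type*} [Field F] {k n m τ δ N : ℕ}
    (hN : 1 ≤ N) (hB : δ + N ≤ τ) (G : Fin (m + 1) → Matrix (Fin k) (Fin n) F)
    (hG : HasColDistSpan m G τ (N + 1) (δ + N + 1)) :
    k * (τ + 1 + δ) ≤ n * (τ + 1 - N) := by
  have key : ∀ L : ℕ, L * (τ + 1 + δ) * k ≤ (L * (τ + 1 - N) + τ) * n := by
    intro L
    set T := L * (τ + 1 + δ) with hT
    let E : Finset ℕ := {t ∈ range (T + τ) | δ + N ≤ t % (τ + 1 + δ)}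
    let ext : (Fin T → Fin k → F) → ℕ → Fin k → F :=
      fun s t => if h : t < T then s ⟨t, h⟩ else 0
    let f : (Fin T → Fin k → F) →ₗ[F] (E → Fin n → F) :=
      { toFun := fun s t => convOutput m G (ext s) t
        map_add' := by
          intro x y; ext t : 1
          simp only [convOutput, Pi.add_apply, ← Finset.sum_add_distrib]
          refine Finset.sum_congr rfl fun i _ => ?_
          by_cases hi : (i : ℕ) ≤ t
          · rw [if_pos hi, if_pos hi, if_pos hi, ← Matrix.add_vecMul]
            congr 1
            by_cases h : (t : ℕ) - i < T <;> simp [ext, h]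
          · simp [hi]
        map_smul' := by
          intro x y; ext t : 1
          simp only [convOutput, Pi.smul_apply, Finset.smul_sum, RingHom.id_apply]
          refine Finset.sum_congr rfl fun i _ => ?_
          by_cases hi : (i : ℕ) ≤ t
          · rw [if_pos hi, if_pos hi, ← Matrix.smul_vecMul]
            congr 1
            by_cases h : (t : ℕ) - i < T <;> simp [ext, h]
          · simp [hi] }
    have hf : Function.Injective f := by
      rw [← LinearMap.ker_eq_bot, LinearMap.ker_eq_bot']
      intro s hs
      have h0 := eq_zero_of_periodic_erasure hN hB G hG (ext s) T (fun t ht htm =>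
        congrFun hs ⟨t, by simp only [E, Finset.mem_filter, Finset.mem_range]; exact ⟨ht, htm⟩⟩)
      ext t : 1
      have := h0 t t.2
      simpa [ext] using this
    have h1 := LinearMap.finrank_le_finrank_of_injective hf
    simp only [Module.finrank_pi_fintype, Module.finrank_self, Finset.sum_const,
      Finset.card_univ, Fintype.card_fin, Fintype.card_coe, smul_eq_mul, mul_one] at h1
    refine h1.trans (Nat.mul_le_mul_right _ ?_)
    have h2 := card_filter_mod_le (δ + N) (τ + 1 - N) τ L
    rwa [show τ + 1 - N + (δ + N) = τ + 1 + δ by omega] at h2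
  by_contra! hcon
  have h1 := key (τ * n + 1)
  have h2 := Nat.mul_le_mul_left (τ * n + 1) (Nat.succ_le_of_lt hcon)
  nlinarith

section BlockCode

variable {K F : Type*} [Field K] [Field F] [Algebra K F]

/-- The polynomial vanishing at the evaluation points of index at least `τ + 1 + r`. -/
noncomputable def tailPoly (b : ℕ → K) (τ δ r : ℕ) : K[X] :=
  ∏ m ∈ Ico (τ + 1 + r) (τ + δ), (X - C (b m))

/-- The polynomial vanishing at the first `s` evaluation points of index at least `δ`. -/
noncomputable def headPoly (b : ℕ → K) (δ s : ℕ) : K[X] :=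
  ∏ m ∈ Ico δ (δ + s), (X - C (b m))

/-- The column multipliers of the code. -/
noncomputable def colWeight (b : ℕ → K) (τ δ j : ℕ) : K :=
  if j < δ then 1 else (tailPoly b τ δ 0).eval (b j)

/-- The parity checks of the block code of length `τ + δ + 1` and redundancy `δ + N`. -/
structure IsBlockCodeword (α : F) (b : ℕ → K) (τ δ N : ℕ) (v : ℕ → F) : Prop where
  burst : ∀ r < δ, α * v r +
    ∑ j ∈ Ico δ (τ + δ), (tailPoly b τ δ r * headPoly b δ (N + r)).eval (b j) • v j = 0
  random : ∀ l < N, ∑ j ∈ range (τ + δ), b j ^ l • colWeight b τ δ j • v j +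
    (if l + 1 = N then v (τ + δ) else 0) = 0

theorem tailPoly_succ (b : ℕ → K) {τ δ r : ℕ} (hr : r + 1 < δ) :
    tailPoly b τ δ r = (X - C (b (τ + 1 + r))) * tailPoly b τ δ (r + 1) := by
  rw [tailPoly, Finset.prod_eq_prod_Ico_succ_bot (by omega), tailPoly, add_assoc (τ + 1)]

theorem eval_tailPoly_eq_zero (b : ℕ → K) {τ δ r j : ℕ} (h1 : τ + 1 + r ≤ j) (h2 : j < τ + δ) :
    (tailPoly b τ δ r).eval (b j) = 0 := by
  rw [tailPoly, eval_prod]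
  exact Finset.prod_eq_zero (Finset.mem_Ico.2 ⟨h1, h2⟩) (by simp)

theorem eval_headPoly_eq_zero (b : ℕ → K) {δ s j : ℕ} (h1 : δ ≤ j) (h2 : j < δ + s) :
    (headPoly b δ s).eval (b j) = 0 := by
  rw [headPoly, eval_prod]
  exact Finset.prod_eq_zero (Finset.mem_Ico.2 ⟨h1, h2⟩) (by simp)

theorem natDegree_headPoly (b : ℕ → K) (δ s : ℕ) : (headPoly b δ s).natDegree = s := by
  rw [headPoly, natDegree_finsetProd_X_sub_C_eq_card, Nat.card_Ico, Nat.add_sub_cancel_left]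

theorem monic_headPoly (b : ℕ → K) (δ s : ℕ) : (headPoly b δ s).Monic :=
  monic_prod_of_monic _ _ fun _ _ => monic_X_sub_C _

theorem coeff_headPoly (b : ℕ → K) (δ : ℕ) {s : ℕ} (hs : 1 ≤ s) :
    (headPoly b δ s).coeff (s - 1) = -∑ j ∈ Ico δ (δ + s), b j := by
  have h := prod_X_sub_C_coeff_card_pred (Ico δ (δ + s)) b
    (by rw [Nat.card_Ico]; omega)
  rwa [Nat.card_Ico, Nat.add_sub_cancel_left] at h

theorem colWeight_ne_zero {b : ℕ → K} {τ δ j : ℕ} (hb : Set.InjOn b (Ico δ (τ + δ)))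
    (hj : j ≤ τ) (hδ : 1 ≤ δ) : colWeight b τ δ j ≠ 0 := by
  unfold colWeight
  split_ifs with h
  · exact one_ne_zero
  · rw [tailPoly, eval_prod, Finset.prod_ne_zero_iff]
    intro m hm
    rw [Finset.mem_Ico] at hm
    rw [eval_sub, eval_X, eval_C, sub_ne_zero]
    intro h'
    have := hb (by simp only [Finset.coe_Ico, Set.mem_Ico]; omega)
      (by simp only [Finset.coe_Ico, Set.mem_Ico]; omega) h'
    omega

namespace IsBlockCodeword

variable {α : F} {b : ℕ → K} {τ δ N : ℕ} {v : ℕ → F}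

theorem sum_eval_add (hv : IsBlockCodeword α b τ δ N v) (hN : 1 ≤ N)
    (h0 : ∀ j < δ, v j = 0) (p : K[X]) (hp : p.natDegree < N) :
    ∑ j ∈ Ico δ (τ + δ), (tailPoly b τ δ 0 * p).eval (b j) • v j +
      p.coeff (N - 1) • v (τ + δ) = 0 := by
  have h1 : ∀ l < N, ∑ j ∈ Ico δ (τ + δ), (b j ^ l * (tailPoly b τ δ 0).eval (b j)) • v j +
      (if l + 1 = N then v (τ + δ) else 0) = 0 := by
    intro l hl
    refine Eq.trans ?_ (hv.random l hl)
    congr 1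
    refine Finset.sum_subset_zero_on_sdiff (fun j hj => ?_) (fun j hj => ?_) (fun j hj => ?_)
    · rw [Finset.mem_Ico] at hj
      rw [Finset.mem_range]
      exact hj.2
    · rw [Finset.mem_sdiff, Finset.mem_range, Finset.mem_Ico] at hj
      rw [h0 j (by omega), smul_zero, smul_zero]
    · rw [Finset.mem_Ico] at hj
      rw [colWeight, if_neg (by omega), mul_smul]
  have h2 : ∑ l ∈ range N, p.coeff l •
      (∑ j ∈ Ico δ (τ + δ), (b j ^ l * (tailPoly b τ δ 0).eval (b j)) • v j +
      (if l + 1 = N then v (τ + δ) else 0)) = 0 :=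
    Finset.sum_eq_zero fun l hl => by rw [h1 l (Finset.mem_range.1 hl), smul_zero]
  rw [← h2]
  simp_rw [smul_add, Finset.sum_add_distrib]
  congr 1
  · simp_rw [Finset.smul_sum]
    rw [Finset.sum_comm]
    refine Finset.sum_congr rfl fun j _ => ?_
    rw [eval_mul, eval_eq_sum_range' hp, Finset.mul_sum, Finset.sum_smul]
    refine Finset.sum_congr rfl fun l _ => ?_
    rw [smul_smul]
    congr 1
    ring
  · rw [Finset.sum_eq_single (N - 1)]
    · rw [if_pos (by omega)]
    · intro l _ hl
      rw [if_neg (by omega), smul_zero]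
    · intro h
      rw [Finset.mem_range] at h
      omega

theorem sum_eval_tailPoly_mul (hv : IsBlockCodeword α b τ δ N v) (hN : 1 ≤ N) (hB : δ + N ≤ τ)
    (hb : Set.InjOn b (Ico δ (τ + δ)))
    (h0 : ∀ j < δ, v j = 0) (hlast : v (τ + δ) = 0) (r : ℕ) (hr : r < δ) (p : K[X])
    (hp : p.natDegree ≤ N + r) :
    ∑ j ∈ Ico δ (τ + δ), (tailPoly b τ δ r * p).eval (b j) • v j = 0 := by
  have hrow : ∀ r < δ,
      ∑ j ∈ Ico δ (τ + δ), (tailPoly b τ δ r * headPoly b δ (N + r)).eval (b j) • v j = 0 := by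
    intro r hr
    have := hv.burst r hr
    rwa [h0 r hr, mul_zero, zero_add] at this
  have hcomb : ∀ (r : ℕ) (c : K) (p p' : K[X]), r < δ →
      tailPoly b τ δ r * p = p' + C c * (tailPoly b τ δ r * headPoly b δ (N + r)) →
      ∑ j ∈ Ico δ (τ + δ), p'.eval (b j) • v j = 0 →
      ∑ j ∈ Ico δ (τ + δ), (tailPoly b τ δ r * p).eval (b j) • v j = 0 := by
    intro r c p p' hr hpp h
    rw [hpp]
    simp_rw [eval_add, add_smul, Finset.sum_add_distrib, h, eval_C_mul, mul_smul,
      ← Finset.smul_sum, hrow r hr, smul_zero, add_zero]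
  induction r generalizing p with
  | zero =>
    refine hcomb 0 (p.coeff N) p
      (tailPoly b τ δ 0 * (p - C (p.coeff N) * headPoly b δ (N + 0))) hr (by ring) ?_
    have hdeg : (p - C (p.coeff N) * headPoly b δ (N + 0)).natDegree < N := by
      rw [Nat.lt_iff_le_pred hN, natDegree_le_iff_coeff_eq_zero]
      intro m hm
      have hmon : (headPoly b δ (N + 0)).coeff N = 1 := by
        have := (monic_headPoly b δ (N + 0)).coeff_natDegree
        rwa [natDegree_headPoly] at this
      rcases eq_or_lt_of_le (show N ≤ m by omega) with rfl | h
      · rw [coeff_sub, coeff_C_mul, hmon, mul_one, sub_self]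
      · rw [coeff_sub, coeff_C_mul, coeff_eq_zero_of_natDegree_lt (p := p) (by omega),
          coeff_eq_zero_of_natDegree_lt (p := headPoly b δ (N + 0))
            (by rw [natDegree_headPoly]; omega), mul_zero, sub_zero]
    have := hv.sum_eval_add hN h0 _ hdeg
    rwa [hlast, smul_zero, add_zero] at this
  | succ r ih =>
    set x := b (τ + 1 + r) with hx
    have hQ : (headPoly b δ (N + (r + 1))).eval x ≠ 0 := by
      rw [headPoly, eval_prod, Finset.prod_ne_zero_iff]
      intro m hm
      rw [Finset.mem_Ico] at hm
      rw [eval_sub, eval_X, eval_C, sub_ne_zero]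
      intro h'
      have := hb (by simp only [Finset.coe_Ico, Set.mem_Ico]; omega)
        (by simp only [Finset.coe_Ico, Set.mem_Ico]; omega) h'
      omega
    set c := p.eval x / (headPoly b δ (N + (r + 1))).eval x with hc
    set q := p - C c * headPoly b δ (N + (r + 1)) with hq
    have hroot : q.IsRoot x := by
      rw [IsRoot, hq, eval_sub, eval_C_mul, hc, div_mul_cancel₀ _ hQ, sub_self]
    have hqdeg : q.natDegree ≤ N + (r + 1) := by
      refine (natDegree_sub_le _ _).trans (max_le hp ?_)
      refine (natDegree_C_mul_le _ _).trans ?_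
      rw [natDegree_headPoly]
    refine hcomb (r + 1) c p (tailPoly b τ δ r * (q /ₘ (X - C x))) hr ?_ ?_
    · have h1 := mul_divByMonic_eq_iff_isRoot.2 hroot
      have h2 : p = q + C c * headPoly b δ (N + (r + 1)) := by rw [hq]; ring
      rw [tailPoly_succ b hr, ← hx]
      calc tailPoly b τ δ (r + 1) * p
          = tailPoly b τ δ (r + 1) * ((X - C x) * (q /ₘ (X - C x)) +
              C c * headPoly b δ (N + (r + 1))) := by rw [h1, ← h2]
        _ = _ := by ring
    · refine ih (by omega) _ ?_
      rw [natDegree_divByMonic _ (monic_X_sub_C x), natDegree_X_sub_C]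
      omega

theorem eq_zero_of_support_subset (hv : IsBlockCodeword α b τ δ N v) (hN : 1 ≤ N) (hδ : 1 ≤ δ)
    (hB : δ + N ≤ τ) (hb : Set.InjOn b (Ico δ (τ + δ))) (S : Finset ℕ)
    (hS : S ⊆ Ico δ (τ + δ)) (hcard : #S ≤ δ + N) (h0 : ∀ j ≤ τ + δ, j ∉ S → v j = 0) :
    ∀ j ∈ S, v j = 0 := by
  refine eq_zero_of_sum_eval_smul S b (hb.mono (Finset.coe_subset.2 hS)) v fun p hp => ?_
  have hmem : ∀ j ∈ S, δ ≤ j ∧ j < τ + δ := fun j hj => Finset.mem_Ico.1 (hS hj)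
  have h1 := hv.sum_eval_tailPoly_mul hN hB hb
    (fun j hj => h0 j (by omega) fun h => by have := hmem j h; omega)
    (h0 _ le_rfl fun h => by have := hmem _ h; omega) (δ - 1) (by omega) p (by omega)
  have h2 : tailPoly b τ δ (δ - 1) = 1 := by
    rw [tailPoly, Finset.Ico_eq_empty (by omega), Finset.prod_empty]
  rw [h2, one_mul] at h1
  rw [← h1]
  refine Finset.sum_subset hS fun j hj hjS => ?_
  rw [h0 j (by rw [Finset.mem_Ico] at hj; omega) hjS, smul_zero]

theorem last_eq_zero (hv : IsBlockCodeword α b τ δ N v) (hN : 1 ≤ N) (hδ : 1 ≤ δ)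
    (hB : δ + N ≤ τ)
    (hsum : ∑ j ∈ Ico δ (δ + N), b j ≠ ∑ j ∈ Ico (τ + 1 - N) (τ + 1), b j)
    (h0 : ∀ j < τ + 1 - N, v j = 0) : v (τ + δ) = 0 := by
  have hdeg : (headPoly b (τ + 1 - N) N - headPoly b δ N).natDegree < N := by
    rw [Nat.lt_iff_le_pred hN, natDegree_le_iff_coeff_eq_zero]
    intro m hm
    have hmon : ∀ δ, (headPoly b δ N).coeff N = 1 := by
      intro δ
      have := (monic_headPoly b δ N).coeff_natDegree
      rwa [natDegree_headPoly] at this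
    rcases eq_or_lt_of_le (show N ≤ m by omega) with rfl | h
    · rw [coeff_sub, hmon, hmon, sub_self]
    · rw [coeff_sub, coeff_eq_zero_of_natDegree_lt (by rw [natDegree_headPoly]; omega),
        coeff_eq_zero_of_natDegree_lt (by rw [natDegree_headPoly]; omega), sub_zero]
  have h1 := hv.sum_eval_add hN (fun j hj => h0 j (by omega)) _ hdeg
  have h2 := hv.burst 0 (by omega)
  rw [h0 0 (by omega), mul_zero, zero_add, add_zero] at h2
  have h3 : ∑ j ∈ Ico δ (τ + δ),
      (tailPoly b τ δ 0 * headPoly b (τ + 1 - N) N).eval (b j) • v j = 0 := by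
    refine Finset.sum_eq_zero fun j hj => ?_
    rw [Finset.mem_Ico] at hj
    rcases lt_or_ge j (τ + 1 - N) with h | h
    · rw [h0 j h, smul_zero]
    rcases lt_or_ge j (τ + 1) with h' | h'
    · rw [eval_mul, eval_headPoly_eq_zero b h (by omega), mul_zero, zero_smul]
    · rw [eval_mul, eval_tailPoly_eq_zero b (by omega) hj.2, zero_mul, zero_smul]
  simp_rw [mul_sub, eval_sub, sub_smul, Finset.sum_sub_distrib, h2, h3, sub_zero,
    zero_add] at h1
  refine (smul_eq_zero.1 h1).resolve_left ?_
  rw [coeff_sub, coeff_headPoly b _ hN, coeff_headPoly b _ hN,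
    show τ + 1 - N + N = τ + 1 by omega]
  intro h
  exact hsum (by linear_combination h)

theorem eq_zero_of_systematic (hv : IsBlockCodeword α b τ δ N v) (hN : 1 ≤ N) (hδ : 1 ≤ δ)
    (hB : δ + N ≤ τ) (hb : Set.InjOn b (Ico δ (τ + δ)))
    (hsum : ∑ j ∈ Ico δ (δ + N), b j ≠ ∑ j ∈ Ico (τ + 1 - N) (τ + 1), b j)
    (h0 : ∀ j < τ + 1 - N, v j = 0) : ∀ j ≤ τ + δ, v j = 0 := by
  have hlast := hv.last_eq_zero hN hδ hB hsum h0
  have h1 := hv.eq_zero_of_support_subset hN hδ hB hb (Ico (τ + 1 - N) (τ + δ))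
    (Finset.Ico_subset_Ico (by omega) le_rfl) (by rw [Nat.card_Ico]; omega)
    (fun j hj hjS => by
      rw [Finset.mem_Ico] at hjS
      rcases lt_or_ge j (τ + 1 - N) with h | h
      · exact h0 j h
      · rw [show j = τ + δ by omega, hlast])
  intro j hj
  rcases lt_or_ge j (τ + 1 - N) with h | h
  · exact h0 j h
  rcases eq_or_lt_of_le hj with rfl | h'
  · exact hlast
  · exact h1 j (Finset.mem_Ico.2 ⟨h, h'⟩)

/-- A burst of `δ + N` erasures starting at position `i` can be corrected at `i`. -/
theorem exists_ne_zero_of_burst (hv : IsBlockCodeword α b τ δ N v) (hN : 1 ≤ N) (hδ : 1 ≤ δ)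
    (hB : δ + N ≤ τ) (hb : Set.InjOn b (Ico δ (τ + δ))) (hα : α ≠ 0) {i : ℕ}
    (hi : i < τ + 1 - N) (h0 : ∀ j < i, v j = 0) (hvi : v i ≠ 0) :
    ∃ j, i + (δ + N) ≤ j ∧ j ≤ i + τ ∧ v j ≠ 0 := by
  by_contra! hcon
  rcases lt_or_ge i δ with hiδ | hiδ
  · have h1 := hv.burst i hiδ
    rw [Finset.sum_eq_zero, add_zero] at h1
    · exact (mul_ne_zero hα hvi) h1
    · intro j hj
      rw [Finset.mem_Ico] at hj
      rcases lt_or_ge j (i + (δ + N)) with h | h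
      · rw [eval_mul, eval_headPoly_eq_zero b hj.1 (by omega), mul_zero, zero_smul]
      rcases lt_or_ge (i + τ) j with h' | h'
      · rw [eval_mul, eval_tailPoly_eq_zero b (by omega) hj.2, zero_mul, zero_smul]
      · rw [hcon j h h', smul_zero]
  · refine hvi (hv.eq_zero_of_support_subset hN hδ hB hb (Ico i (i + (δ + N)))
      (Finset.Ico_subset_Ico hiδ (by omega)) (by rw [Nat.card_Ico]; omega)
      (fun j hj hjS => ?_) i (Finset.mem_Ico.2 ⟨le_rfl, by omega⟩))
    rw [Finset.mem_Ico] at hjS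
    rcases lt_or_ge j i with h | h
    · exact h0 j h
    · exact hcon j (by omega) (by omega)

/-- Any `N` erasures can be corrected at the first erased position `i`. -/
theorem lt_ncard (hv : IsBlockCodeword α b τ δ N v) (hN : 1 ≤ N) (hδ : 1 ≤ δ)
    (hB : δ + N ≤ τ) (hb : Set.InjOn b (Ico δ (τ + δ))) (hb' : Set.InjOn b (range (τ + 1)))
    (hα : α ∉ (1 : Submodule K F)) {i : ℕ}
    (hi : i < τ + 1 - N) (h0 : ∀ j < i, v j = 0) (hvi : v i ≠ 0) :
    N < {j | j ∈ Icc i (i + τ) ∧ v j ≠ 0}.ncard := by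
  classical
  by_contra! hcon
  have hfin : {j | j ∈ Icc i (i + τ) ∧ v j ≠ 0}.Finite :=
    (Finset.finite_toSet (Icc i (i + τ))).subset fun j hj => hj.1
  set W : Finset ℕ := {j ∈ Icc i τ | v j ≠ 0} with hW
  have hmemW : ∀ j, j ∈ W ↔ (i ≤ j ∧ j ≤ τ) ∧ v j ≠ 0 := by
    intro j; rw [hW, Finset.mem_filter, Finset.mem_Icc]
  have hiW : i ∈ W := (hmemW i).2 ⟨⟨le_rfl, by omega⟩, hvi⟩
  have hWle : #W ≤ N := by
    rw [← Set.ncard_coe_finset]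
    refine (Set.ncard_le_ncard (fun j hj => ?_) hfin).trans hcon
    have hj := (hmemW j).1 hj
    exact ⟨Finset.mem_Icc.2 ⟨hj.1.1, by omega⟩, hj.2⟩
  have hinjW : Set.InjOn b W := hb'.mono fun j hj => by
    have hj := (hmemW j).1 hj
    simp only [Finset.coe_range, Set.mem_Iio]
    omega
  have hsumW : ∀ l, ∑ j ∈ range (τ + δ), b j ^ l • colWeight b τ δ j • v j =
      ∑ j ∈ W, b j ^ l • colWeight b τ δ j • v j := by
    intro l
    refine (Finset.sum_subset (fun j hj => ?_) fun j hj hjW => ?_).symm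
    · have := (hmemW j).1 hj
      rw [Finset.mem_range]
      omega
    · rw [Finset.mem_range] at hj
      rcases lt_or_ge τ j with h | h
      · rw [colWeight, if_neg (by omega), eval_tailPoly_eq_zero b (by omega) hj, zero_smul,
          smul_zero]
      · by_cases hji : i ≤ j
        · have : v j = 0 := by
            by_contra hne
            exact hjW ((hmemW j).2 ⟨⟨hji, h⟩, hne⟩)
          rw [this, smul_zero, smul_zero]
        · rw [h0 j (by omega), smul_zero, smul_zero]
  have hw : ∀ j ≤ τ, colWeight b τ δ j ≠ 0 := fun j hj => colWeight_ne_zero hb hj hδ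
  have hdone : (∀ l < #W, ∑ j ∈ W, b j ^ l • colWeight b τ δ j • v j = 0) → False := by
    intro h
    have := eq_zero_of_sum_pow_smul W b hinjW (fun j => colWeight b τ δ j • v j) h i hiW
    exact hvi ((smul_eq_zero.1 this).resolve_left (hw i (by omega)))
  have hrand : ∀ l, l + 1 < N → ∑ j ∈ W, b j ^ l • colWeight b τ δ j • v j = 0 := by
    intro l hl
    have := hv.random l (by omega)
    rwa [if_neg (by omega), add_zero, hsumW] at this
  have hWN : #W = N := by
    by_contra hne
    exact hdone fun l hl => hrand l (by omega)
  have htail : ∀ j, τ < j → j ≤ i + τ → v j = 0 := by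
    intro j hj1 hj2
    by_contra hne
    have hjW : j ∉ W := fun h => by have := (hmemW j).1 h; omega
    have h1 : #(insert j W) ≤ N := by
      rw [← Set.ncard_coe_finset]
      refine (Set.ncard_le_ncard (fun m hm => ?_) hfin).trans hcon
      rcases Finset.mem_insert.1 (Finset.mem_coe.1 hm) with rfl | hm
      · exact ⟨Finset.mem_Icc.2 ⟨by omega, hj2⟩, hne⟩
      · have hm := (hmemW m).1 hm
        exact ⟨Finset.mem_Icc.2 ⟨hm.1.1, by omega⟩, hm.2⟩
    rw [Finset.card_insert_of_notMem hjW] at h1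
    omega
  rcases lt_or_ge i δ with hiδ | hiδ
  · have hmem : ∀ j ∈ W.erase i,
        colWeight b τ δ j • (v j / v i) ∈ (1 : Submodule K F) := by
      refine mem_one_of_sum_pow_smul (W.erase i) b
        (hinjW.mono (Finset.coe_subset.2 (Finset.erase_subset _ _))) _ fun l hl => ?_
      rw [Finset.card_erase_of_mem hiW] at hl
      have h1 : ∑ j ∈ W, b j ^ l • colWeight b τ δ j • (v j / v i) = 0 := by
        have := congrArg (· / v i) (hrand l (by omega))
        simpa only [Finset.sum_div, zero_div, Algebra.smul_def, mul_div_assoc] using this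
      rw [← Finset.add_sum_erase _ _ hiW, add_comm] at h1
      rw [eq_neg_of_add_eq_zero_left h1, div_self hvi]
      exact Submodule.neg_mem _ (Submodule.smul_mem _ _ (Submodule.smul_mem _ _
        (Submodule.mem_one.2 ⟨1, map_one _⟩)))
    refine hα ?_
    have h1 := congrArg (· / v i) (hv.burst i hiδ)
    simp only [add_div, mul_div_cancel_right₀ _ hvi, zero_div, Finset.sum_div] at h1
    rw [eq_neg_of_add_eq_zero_left h1]
    refine Submodule.neg_mem _ (Submodule.sum_mem _ fun j hj => ?_)
    rw [Finset.mem_Ico] at hj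
    rcases lt_or_ge (i + τ) j with h | h
    · rw [eval_mul, eval_tailPoly_eq_zero b (by omega) hj.2, zero_mul, zero_smul, zero_div]
      exact Submodule.zero_mem _
    by_cases hvj : v j = 0
    · rw [hvj, smul_zero, zero_div]
      exact Submodule.zero_mem _
    have hjτ : j ≤ τ := by
      by_contra hjτ
      exact hvj (htail j (by omega) h)
    have h2 := hmem j (Finset.mem_erase.2 ⟨by omega, (hmemW j).2 ⟨⟨by omega, hjτ⟩, hvj⟩⟩)
    rw [Submodule.smul_mem_iff _ (hw j hjτ)] at h2
    rw [Algebra.smul_def, mul_div_assoc, ← Algebra.smul_def]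
    exact Submodule.smul_mem _ _ h2
  · refine hdone fun l hl => ?_
    have := hv.random l (by omega)
    rwa [htail (τ + δ) (by omega) (by omega), ite_self, add_zero, hsumW] at this

end IsBlockCodeword

end BlockCode

theorem exists_hasColDistSpan_of_lt {K F : Type*} [Field K] [Field F] [Algebra K F]
    {α : F} {b : ℕ → K} {τ δ N : ℕ} (hN : 1 ≤ N) (hδ : 1 ≤ δ) (hB : δ + N ≤ τ)
    (hb : Set.InjOn b (Ico δ (τ + δ))) (hb' : Set.InjOn b (range (τ + 1)))
    (hsum : ∑ j ∈ Ico δ (δ + N), b j ≠ ∑ j ∈ Ico (τ + 1 - N) (τ + 1), b j)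
    (hα : α ∉ (1 : Submodule K F)) :
    ∃ (m : ℕ) (G : Fin (m + 1) → Matrix (Fin (τ + 1 - N)) (Fin (τ + 1 - N + (δ + N))) F),
      HasColDistSpan m G τ (N + 1) (δ + N + 1) := by
  let Φ : (ℕ → F) →ₗ[F] (Fin (δ + N) → F) := LinearMap.pi fun r =>
    if (r : ℕ) < δ then
      α • LinearMap.proj (r : ℕ) + ∑ j ∈ Ico δ (τ + δ), algebraMap K F
        ((tailPoly b τ δ r * headPoly b δ (N + r)).eval (b j)) • LinearMap.proj j
    else
      ∑ j ∈ range (τ + δ), algebraMap K F (b j ^ (r - δ : ℕ)) •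
        algebraMap K F (colWeight b τ δ j) • LinearMap.proj j +
        if r - δ + 1 = N then LinearMap.proj (τ + δ) else 0
  have hΦ : ∀ v, Φ v = 0 → IsBlockCodeword α b τ δ N v := by
    intro v hv
    constructor
    · intro r hr
      have := congrFun hv ⟨r, by omega⟩
      simp only [Φ, LinearMap.pi_apply, if_pos hr, LinearMap.add_apply, LinearMap.smul_apply,
        LinearMap.sum_apply, LinearMap.proj_apply, smul_eq_mul, Pi.zero_apply] at this
      simpa only [Algebra.smul_def] using this
    · intro l hl
      have := congrFun hv ⟨δ + l, by omega⟩
      simp only [Φ, LinearMap.pi_apply, if_neg (show ¬ δ + l < δ by omega), LinearMap.add_apply,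
        LinearMap.smul_apply, LinearMap.sum_apply, LinearMap.proj_apply, smul_eq_mul,
        Pi.zero_apply, Nat.add_sub_cancel_left] at this
      simp only [Algebra.smul_def]
      refine Eq.trans ?_ this
      congr 1
      split_ifs <;> rfl
  have hα0 : α ≠ 0 := by
    rintro rfl
    exact hα (Submodule.zero_mem _)
  refine exists_hasColDistSpan_of_parity τ (N + 1) (δ + N + 1) (τ + 1 - N) (δ + N) Φ ?_ ?_
  · intro v hsupp hv
    have h0 : ∀ j, ¬ (τ + 1 - N ≤ j ∧ j < τ + 1 - N + (δ + N)) → v j = 0 := by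
      intro j hj
      by_contra hne
      exact hj (hsupp j hne)
    have h1 := (hΦ v hv).eq_zero_of_systematic hN hδ hB hb hsum
      (fun j hj => h0 j (by omega))
    ext j
    rcases le_or_gt j (τ + δ) with h | h
    · exact h1 j h
    · exact h0 j (by omega)
  · intro i hi v h0 hvi _ hv
    exact ⟨(hΦ v hv).lt_ncard hN hδ hB hb hb' hα hi h0 hvi,
      (hΦ v hv).exists_ne_zero_of_burst hN hδ hB hb hα0 hi h0 hvi⟩

theorem exists_hasColDistSpan_self {F : Type*} [Field F] {b : ℕ → F} {τ N : ℕ} (hN : N ≤ τ)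
    (hb : Set.InjOn b (range (τ + 1))) :
    ∃ (m : ℕ) (G : Fin (m + 1) → Matrix (Fin (τ + 1 - N)) (Fin (τ + 1 - N + N)) F),
      HasColDistSpan m G τ (N + 1) (N + 1) := by
  classical
  let Φ : (ℕ → F) →ₗ[F] (Fin N → F) := LinearMap.pi fun l =>
    ∑ j ∈ range (τ + 1), (b j ^ (l : ℕ)) • LinearMap.proj j
  have hΦ : ∀ v, Φ v = 0 → ∀ S ⊆ range (τ + 1), #S ≤ N →
      (∀ j ≤ τ, j ∉ S → v j = 0) → ∀ j ∈ S, v j = 0 := by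
    intro v hv S hS hcard h0
    refine eq_zero_of_sum_pow_smul S b (hb.mono (Finset.coe_subset.2 hS)) v fun l hl => ?_
    have := congrFun hv ⟨l, by omega⟩
    simp only [Φ, LinearMap.pi_apply, LinearMap.sum_apply, LinearMap.smul_apply,
      LinearMap.proj_apply, Pi.zero_apply] at this
    rw [← this]
    refine Finset.sum_subset hS fun j hj hjS => ?_
    rw [Finset.mem_range] at hj
    rw [h0 j (by omega) hjS, smul_zero]
  refine exists_hasColDistSpan_of_parity τ (N + 1) (N + 1) (τ + 1 - N) N Φ ?_ ?_
  · intro v hsupp hv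
    have h0 : ∀ j, j ∉ Ico (τ + 1 - N) (τ + 1) → v j = 0 := by
      intro j hj
      by_contra hne
      have := hsupp j hne
      exact hj (Finset.mem_Ico.2 (by omega))
    ext j
    by_cases hj : j ∈ Ico (τ + 1 - N) (τ + 1)
    · refine hΦ v hv (Ico (τ + 1 - N) (τ + 1)) (fun m hm => ?_) ?_ (fun j _ => h0 j) j hj
      · rw [Finset.mem_Ico] at hm
        exact Finset.mem_range.2 hm.2
      · rw [Nat.card_Ico]; omega
    · exact h0 j hj
  · intro i hi v h0 hvi hend hv
    constructor
    · by_contra! hcon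
      have hfin : {j | j ∈ Icc i (i + τ) ∧ v j ≠ 0}.Finite :=
        (Finset.finite_toSet (Icc i (i + τ))).subset fun j hj => hj.1
      refine hvi (hΦ v hv {j ∈ Icc i τ | v j ≠ 0} (fun j hj => ?_) ?_ (fun j hj hjS => ?_) i ?_)
      · rw [Finset.mem_filter, Finset.mem_Icc] at hj
        exact Finset.mem_range.2 (by omega)
      · rw [← Set.ncard_coe_finset]
        refine (Set.ncard_le_ncard (fun j hj => ?_) hfin).trans (Nat.lt_succ_iff.1 hcon)
        rw [Finset.mem_coe, Finset.mem_filter, Finset.mem_Icc] at hj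
        exact ⟨Finset.mem_Icc.2 ⟨hj.1.1, by omega⟩, hj.2⟩
      · by_contra hne
        refine hjS (Finset.mem_filter.2 ⟨Finset.mem_Icc.2 ⟨?_, hj⟩, hne⟩)
        by_contra hlt
        exact hne (h0 j (by omega))
      · exact Finset.mem_filter.2 ⟨Finset.mem_Icc.2 ⟨le_rfl, by omega⟩, hvi⟩
    · by_contra! hcon
      have hN0 : 1 ≤ N := by
        by_contra hN0
        exact hvi (hcon i (by omega) (by omega))
      refine hvi (hΦ v hv (Ico i (i + N)) (fun j hj => ?_) (by rw [Nat.card_Ico]; omega)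
        (fun j hj hjS => ?_) i (Finset.mem_Ico.2 ⟨le_rfl, by omega⟩))
      · rw [Finset.mem_Ico] at hj
        exact Finset.mem_range.2 (by omega)
      · rw [Finset.mem_Ico] at hjS
        rcases lt_or_ge j i with h | h
        · exact h0 j h
        · exact hcon j (by omega) (by omega)

theorem exists_injOn_range {K : Type*} [Fintype K] [Nonempty K] {s : ℕ}
    (h : s ≤ Fintype.card K) : ∃ a : ℕ → K, Set.InjOn a (range s) := by
  obtain ⟨f⟩ := Function.Embedding.nonempty_of_card_le (α := Fin s) (β := K) (by simpa using h)
  refine ⟨fun j => if h : j < s then f ⟨j, h⟩ else Classical.arbitrary K, ?_⟩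
  intro x hx y hy hxy
  rw [Finset.coe_range, Set.mem_Iio] at hx hy
  simp only [hx, hy, dif_pos] at hxy
  simpa using f.injective hxy

theorem exists_injOn_sum_ne {K : Type*} [Field K] [Fintype K] {τ δ N : ℕ} (hN : 1 ≤ N)
    (hδ : 1 ≤ δ) (hB : δ + N ≤ τ) (h : τ + 1 ≤ Fintype.card K) :
    ∃ a : ℕ → K, Set.InjOn a (range (τ + 1)) ∧
      ∑ j ∈ Ico δ (δ + N), a j ≠ ∑ j ∈ Ico (τ + 1 - N) (τ + 1), a j := by
  obtain ⟨a, ha⟩ := exists_injOn_range h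
  by_cases hsum : ∑ j ∈ Ico δ (δ + N), a j = ∑ j ∈ Ico (τ + 1 - N) (τ + 1), a j
  swap
  · exact ⟨a, ha, hsum⟩
  refine ⟨a ∘ Equiv.swap 0 δ, ha.comp (Equiv.injective _).injOn ?_, ?_⟩
  · intro j hj
    simp only [Finset.coe_range, Set.mem_Iio] at hj ⊢
    rw [Equiv.swap_apply_def]
    split_ifs <;> omega
  · have h1 : ∀ j, 1 ≤ j → j ≠ δ → (a ∘ Equiv.swap 0 δ) j = a j := by
      intro j hj hjδ
      rw [Function.comp_apply, Equiv.swap_apply_of_ne_of_ne (by omega) hjδ]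
    have h2 : ∑ j ∈ Ico (τ + 1 - N) (τ + 1), (a ∘ Equiv.swap 0 δ) j =
        ∑ j ∈ Ico (τ + 1 - N) (τ + 1), a j := by
      refine Finset.sum_congr rfl fun j hj => ?_
      rw [Finset.mem_Ico] at hj
      exact h1 j (by omega) (by omega)
    have h3 : ∑ j ∈ Ico (δ + 1) (δ + N), (a ∘ Equiv.swap 0 δ) j =
        ∑ j ∈ Ico (δ + 1) (δ + N), a j := by
      refine Finset.sum_congr rfl fun j hj => ?_
      rw [Finset.mem_Ico] at hj
      exact h1 j (by omega) (by omega)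
    rw [h2, ← hsum, Finset.sum_eq_sum_Ico_succ_bot (show δ < δ + N by omega) (a ∘ Equiv.swap 0 δ),
      h3, Finset.sum_eq_sum_Ico_succ_bot (show δ < δ + N by omega) a, Function.comp_apply, Equiv.swap_apply_right]
    intro h4
    have := ha (by simp) (by simp only [Finset.coe_range, Set.mem_Iio]; omega)
      (add_right_cancel h4)
    omega

theorem injOn_comp_mod {K : Type*} {a : ℕ → K} {τ δ : ℕ} (hδ : δ ≤ τ)
    (ha : Set.InjOn a (range (τ + 1))) :
    Set.InjOn (fun j => a (j % (τ + 1))) (Ico δ (τ + δ)) := by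
  have hmod : ∀ j < τ + δ, j % (τ + 1) = if j < τ + 1 then j else j - (τ + 1) := by
    intro j hj
    split_ifs with h
    · exact Nat.mod_eq_of_lt h
    · rw [Nat.mod_eq_sub_mod (by omega), Nat.mod_eq_of_lt (by omega)]
  intro x hx y hy hxy
  rw [Finset.coe_Ico, Set.mem_Ico] at hx hy
  have h := ha (by simpa using Nat.mod_lt x (Nat.succ_pos τ))
    (by simpa using Nat.mod_lt y (Nat.succ_pos τ)) hxy
  rw [hmod x hx.2, hmod y hy.2] at h
  split_ifs at h <;> omega

theorem exists_subfield_embedding {F : Type*} [Field F] [Fintype F] {q : ℕ} (hq : IsPrimePow q)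
    (hF : Fintype.card F = q ^ 2) :
    ∃ (K : Type) (_ : Field K) (_ : Fintype K) (_ : Algebra K F),
      Fintype.card K = q ∧ ∃ α : F, α ∉ (1 : Submodule K F) := by
  obtain ⟨p, e, hp, he, rfl⟩ := hq
  rw [← Nat.prime_iff] at hp
  have : Fact p.Prime := ⟨hp⟩
  rw [← pow_mul] at hF
  have : CharP F p := charP_of_card_eq_prime_pow hF
  let : Algebra (ZMod p) F := ZMod.algebra F p
  have hK : Nat.card (GaloisField p e) = p ^ e := GaloisField.card p e (by omega)
  have : Finite (GaloisField p e) := Nat.finite_of_card_ne_zero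
    (by rw [hK]; exact pow_ne_zero _ hp.ne_zero)
  let : Fintype (GaloisField p e) := Fintype.ofFinite _
  have hFr : Module.finrank (ZMod p) F = e * 2 := by
    have := FiniteField.pow_finrank_eq_card p F
    rw [hF] at this
    exact Nat.pow_right_injective hp.two_le this
  obtain ⟨f⟩ := FiniteField.nonempty_algHom_of_finrank_dvd (F := ZMod p)
    (K := GaloisField p e) (L := F) (by
      rw [hFr, GaloisField.finrank p (by omega)]; exact Nat.dvd_mul_right e 2)
  let : Algebra (GaloisField p e) F := f.toRingHom.toAlgebra
  rw [Nat.card_eq_fintype_card] at hK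
  refine ⟨GaloisField p e, inferInstance, inferInstance, inferInstance, hK, ?_⟩
  by_contra! hall
  have hsurj : Function.Surjective (algebraMap (GaloisField p e) F) := fun x =>
    Submodule.mem_one.1 (hall x)
  have h1 := Fintype.card_le_of_surjective _ hsurj
  rw [hK, hF] at h1
  have h2 : p ^ e < p ^ (e * 2) := Nat.pow_lt_pow_right hp.one_lt (by omega)
  omega

/-- For all `τ ≥ 1`, `2 ≤ d ≤ c ≤ τ + 1`, and every prime power
`q ≥ τ + 1`, there exists a convolutional code over the field with `q²` elements
with `k = τ - d + 2` and `n = τ - d + c + 1` whose column distance at delay `τ` is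
at least `d` and column span at delay `τ` is at least `c`; moreover its rate
`k/n = (τ-d+2)/(τ-d+c+1)` is the maximum possible rate of any convolutional code
with column distance `d` and column span `c` at delay `τ`. -/
theorem statement14 (τ d c q : ℕ) (hτ : 1 ≤ τ) (hd : 2 ≤ d) (hdc : d ≤ c)
    (hc : c ≤ τ + 1) (hq : IsPrimePow q) (hqτ : τ + 1 ≤ q)
    (F : Type*) [Field F] [Fintype F] (hF : Fintype.card F = q ^ 2) :
    (∃ (m : ℕ) (G : Fin (m + 1) → Matrix (Fin (τ + 2 - d)) (Fin (τ + 1 + c - d)) F),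
        HasColDistSpan m G τ d c) ∧
    (∀ (k' n' m' : ℕ) (G' : Fin (m' + 1) → Matrix (Fin k') (Fin n') F),
        1 ≤ k' → HasColDistSpan m' G' τ d c →
        k' * (τ + 1 + c - d) ≤ n' * (τ + 2 - d)) := by
  obtain ⟨N, rfl⟩ : ∃ N, d = N + 1 := ⟨d - 1, by omega⟩
  obtain ⟨δ, rfl⟩ : ∃ δ, c = δ + N + 1 := ⟨c - (N + 1), by omega⟩
  rw [show τ + 2 - (N + 1) = τ + 1 - N by omega]
  constructor
  · rw [show τ + 1 + (δ + N + 1) - (N + 1) = τ + 1 - N + (δ + N) by omega]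
    obtain ⟨K, _, _, _, hK, α, hα⟩ := exists_subfield_embedding hq hF
    rcases Nat.eq_zero_or_pos δ with rfl | hδ
    · have hcard : τ + 1 ≤ Fintype.card F := by
        rw [hF]
        nlinarith
      obtain ⟨a, ha⟩ := exists_injOn_range hcard
      rw [Nat.zero_add]
      exact exists_hasColDistSpan_self (by omega) ha
    · obtain ⟨a, ha, hsum⟩ := exists_injOn_sum_ne (K := K) (τ := τ) (δ := δ) (N := N)
        (by omega) hδ (by omega) (by omega)
      have hmod : ∀ j < τ + 1, a (j % (τ + 1)) = a j := fun j hj => by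
        rw [Nat.mod_eq_of_lt hj]
      refine exists_hasColDistSpan_of_lt (b := fun j => a (j % (τ + 1))) (by omega) hδ (by omega)
        (injOn_comp_mod (by omega) ha) (fun x hx y hy hxy => ha hx hy ?_) ?_ hα
      · rw [Finset.coe_range, Set.mem_Iio] at hx hy
        simpa only [hmod x hx, hmod y hy] using hxy
      · rwa [Finset.sum_congr rfl fun j hj => hmod j (by rw [Finset.mem_Ico] at hj; omega),
          Finset.sum_congr (s₁ := Ico (τ + 1 - N) (τ + 1)) rfl fun j hj =>
            hmod j (by rw [Finset.mem_Ico] at hj; omega)]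
  · intro k' n' m' G' _ hG
    rw [show τ + 1 + (δ + N + 1) - (N + 1) = τ + 1 + δ by omega]
    exact rate_le (by omega) (by omega) G' hG
end

section
/- Let 1 ≤ a ≤ b ≤ τ, let F be a finite field, set n = τ+b-a+1, and let C ⊆ F^n be an (a,b,τ)-delay-recoverable linear code. Let x, x' : ℤ → F^n be two coded streams with x(t) = 0 and x'(t) = 0 for all t < 0, such that for every t ∈ ℤ the diagonal vector (x_0(t), x_1(t+1), ..., x_{n-1}(t+n-1)) belongs to C, and likewise for x'. Let E ⊆ ℕ be an erasure set admissible for the sliding-window channel with parameters (a, b, w = τ+1). Then for every t ∈ ℕ: if x(t') = x'(t') for all t' ∉ E with 0 ≤ t' ≤ t+τ, then x(t) = x'(t). (That is, the streaming code obtained by diagonal embedding of C recovers every coded packet from every admissible erasure pattern with delay at most τ.) -/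
/-- A linear code `C ⊆ F^n` (with `n = τ + b - a + 1`) is `(a,b,τ)`-delay-recoverable
if (i) [burst recovery] for every coordinate `ℓ`, any two codewords agreeing on all
coordinates `j < ℓ` and on all coordinates `j` with `ℓ + b ≤ j ≤ ℓ + τ` agree at `ℓ`,
and (ii) [random-erasure recovery] for every `ℓ` and every erasure set
`E ⊆ [ℓ, ℓ+τ]` with `ℓ ∈ E` and `|E| ≤ a`, any two codewords agreeing on all
coordinates `j < ℓ` and on all coordinates `j ∈ (ℓ, ℓ+τ] \ E` agree at `ℓ`. -/
def DelayRecoverable {F : Type*} [Field F] {n : ℕ} (a b τ : ℕ)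
    (C : Submodule F (Fin n → F)) : Prop :=
  (∀ (ℓ : Fin n) (c c' : Fin n → F), c ∈ C → c' ∈ C →
      (∀ j : Fin n, (j : ℕ) < (ℓ : ℕ) → c j = c' j) →
      (∀ j : Fin n, (ℓ : ℕ) + b ≤ (j : ℕ) → (j : ℕ) ≤ (ℓ : ℕ) + τ → c j = c' j) →
      c ℓ = c' ℓ) ∧
  (∀ (ℓ : Fin n) (E : Finset (Fin n)), ℓ ∈ E →
      (∀ j ∈ E, (ℓ : ℕ) ≤ (j : ℕ) ∧ (j : ℕ) ≤ (ℓ : ℕ) + τ) → E.card ≤ a →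
      ∀ (c c' : Fin n → F), c ∈ C → c' ∈ C →
        (∀ j : Fin n, (j : ℕ) < (ℓ : ℕ) → c j = c' j) →
        (∀ j : Fin n, (ℓ : ℕ) < (j : ℕ) → (j : ℕ) ≤ (ℓ : ℕ) + τ → j ∉ E → c j = c' j) →
        c ℓ = c' ℓ)

/-- An erasure set `E ⊆ ℕ` is admissible for the sliding-window channel with
parameters `(a, b, w)` if in every window of `w` consecutive time slots, the
erasures are either contained in a single interval of at most `b` consecutive
integers (a burst), or number at most `a` (random erasures). -/
def SWAdmissible (a b w : ℕ) (E : Set ℕ) : Prop :=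
  ∀ j : ℕ,
    (∃ i : ℕ, E ∩ Set.Ico j (j + w) ⊆ Set.Ico i (i + b)) ∨
    (E ∩ Set.Ico j (j + w)).ncard ≤ a

/-- Diagonal embedding of an `(a,b,τ)`-delay-recoverable block
code of length `n = τ + b - a + 1` yields a streaming code recovering every coded
packet, with delay at most `τ`, from every erasure pattern admissible for the
sliding-window channel with parameters `(a, b, w = τ+1)`: if `x, x'` are two coded
streams (vanishing at negative times, all of whose diagonals lie in `C`) which
agree at all non-erased times `t' ≤ t + τ`, then they agree at time `t`. -/
theorem statement15 (a b τ : ℕ) (ha : 1 ≤ a) (hab : a ≤ b) (hbτ : b ≤ τ)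
    {F : Type*} [Field F] [Fintype F]
    (C : Submodule F (Fin (τ + b - a + 1) → F))
    (hC : DelayRecoverable a b τ C)
    (x x' : ℤ → Fin (τ + b - a + 1) → F)
    (hx0 : ∀ t : ℤ, t < 0 → x t = 0) (hx'0 : ∀ t : ℤ, t < 0 → x' t = 0)
    (hxC : ∀ t : ℤ, (fun j : Fin (τ + b - a + 1) => x (t + (j : ℕ)) j) ∈ C)
    (hx'C : ∀ t : ℤ, (fun j : Fin (τ + b - a + 1) => x' (t + (j : ℕ)) j) ∈ C)
    (E : Set ℕ) (hE : SWAdmissible a b (τ + 1) E)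
    (t : ℕ)
    (hagree : ∀ t' : ℕ, t' ∉ E → t' ≤ t + τ → x (t' : ℤ) = x' (t' : ℤ)) :
    x (t : ℤ) = x' (t : ℤ) := by
  classical
  induction t using Nat.strong_induction_on with
  | _ t ih =>
  by_cases htE : t ∈ E
  swap
  · exact hagree t htE (by omega)
  have hpast : ∀ s : ℤ, s < t → x s = x' s := by
    intro s hs
    rcases lt_or_ge s 0 with h | h
    · rw [hx0 s h, hx'0 s h]
    · lift s to ℕ using h
      exact ih s (by omega) fun t' h₁ h₂ => hagree t' h₁ (by omega)
  funext ℓ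
  have key : ∀ c c' : Fin (τ + b - a + 1) → F,
      c = (fun j : Fin (τ + b - a + 1) => x ((t : ℤ) - (ℓ : ℕ) + (j : ℕ)) j) →
      c' = (fun j : Fin (τ + b - a + 1) => x' ((t : ℤ) - (ℓ : ℕ) + (j : ℕ)) j) → c ℓ = c' ℓ := by
    intro c c' hc hc'
    have hcC : c ∈ C := hc ▸ hxC _
    have hcC' : c' ∈ C := hc' ▸ hx'C _
    have hlt : ∀ j : Fin (τ + b - a + 1), (j : ℕ) < (ℓ : ℕ) → c j = c' j := by
      intro j hj
      simp only [hc, hc']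
      rw [hpast _ (by omega)]
    have hfut : ∀ j : Fin (τ + b - a + 1), (ℓ : ℕ) ≤ j → (j : ℕ) ≤ ℓ + τ →
        t + (j - ℓ : ℕ) ∉ E → c j = c' j := by
      intro j h₁ h₂ h₃
      have h := hagree _ h₃ (by omega)
      have heq : (t : ℤ) - (ℓ : ℕ) + (j : ℕ) = ((t + (j - ℓ : ℕ) : ℕ) : ℤ) := by omega
      simp only [hc, hc']
      rw [heq, h]
    rcases hE t with ⟨i, hi⟩ | hcard
    · refine hC.1 ℓ c c' hcC hcC' hlt fun j h₁ h₂ => hfut j (by omega) h₂ fun hmem => ?_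
      have hit := (Set.mem_Ico.1 (hi ⟨htE, Set.mem_Ico.2 (by omega)⟩)).1
      have hib := (Set.mem_Ico.1 (hi ⟨hmem, Set.mem_Ico.2 (by omega)⟩)).2
      omega
    · let S : Finset (Fin (τ + b - a + 1)) := Finset.univ.filter fun j =>
        (ℓ : ℕ) ≤ j ∧ (j : ℕ) ≤ ℓ + τ ∧ t + (j - ℓ : ℕ) ∈ E
      have hS : ∀ j, j ∈ S ↔ (ℓ : ℕ) ≤ j ∧ (j : ℕ) ≤ ℓ + τ ∧ t + (j - ℓ : ℕ) ∈ E := by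
        simp [S]
      refine hC.2 ℓ S ((hS ℓ).2 ⟨le_rfl, by omega, by simpa using htE⟩)
        (fun j hj => ⟨((hS j).1 hj).1, ((hS j).1 hj).2.1⟩) ?_ c c' hcC hcC' hlt
        fun j h₁ h₂ h₃ => hfut j h₁.le h₂ fun hmem => h₃ ((hS j).2 ⟨h₁.le, h₂, hmem⟩)
      rw [← Set.ncard_coe_finset]
      refine le_trans (Set.ncard_le_ncard_of_injOn (fun j => t + (j - ℓ : ℕ)) ?_ ?_
        ((Set.finite_Ico t (t + (τ + 1))).subset Set.inter_subset_right)) hcard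
      · intro j hj
        have hj' := (hS j).1 hj
        exact ⟨hj'.2.2, Set.mem_Ico.2 (by omega)⟩
      · intro j hj k hk hjk
        have hj' := ((hS j).1 hj).1
        have hk' := ((hS k).1 hk).1
        apply Fin.ext
        simp only at hjk
        omega
  simpa using key _ _ rfl rfl
end

section
/- Let 1 ≤ a ≤ b ≤ τ, let F be a finite field, set n = τ+b-a+1 and δ = b-a, let H be a b × n matrix over F with columns h_0, ..., h_{n-1}, and let C = {x ∈ F^n : Hx = 0}. For each ℓ with 0 ≤ ℓ ≤ δ-1, let H^(ℓ) be any matrix with columns indexed by {0,...,ℓ+τ} whose rows span the dual code of the restriction of C to the coordinates {0,...,ℓ+τ}, with columns denoted h^(ℓ)_0, ..., h^(ℓ)_{ℓ+τ}. Then C is (a,b,τ)-delay-recoverable if and only if the following four conditions hold: (B1) for every 0 ≤ ℓ ≤ δ-1, h^(ℓ)_ℓ does not lie in the span of {h^(ℓ)_j : ℓ+1 ≤ j ≤ ℓ+b-1}; (B2) for every δ ≤ ℓ ≤ n-b, the columns {h_j : ℓ ≤ j ≤ ℓ+b-1} are linearly independent; (R1) for every 0 ≤ ℓ ≤ δ-1,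 h^(ℓ)_ℓ does not lie in the span of any a-1 columns drawn from {h^(ℓ)_j : ℓ+1 ≤ j ≤ ℓ+τ}; (R2) any a columns drawn from {h_j : δ ≤ j ≤ n-1} are linearly independent. -/
section Columns

variable {F : Type*} [Field F] {m ι : Type*} [Fintype ι]

/-- A column lies in the span of a set of other columns iff some kernel vector is nonzero at that
column and otherwise supported on the set. -/
lemma Matrix.col_mem_span_image_iff (M : Matrix m ι F) {i : ι} {S : Set ι} (hi : i ∉ S) :
    M.col i ∈ Submodule.span F (M.col '' S) ↔
      ∃ y : ι → F, M.mulVec y = 0 ∧ y i ≠ 0 ∧ ∀ j, j ≠ i → j ∉ S → y j = 0 := by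
  classical
  constructor
  · intro h
    obtain ⟨l, hl, hli⟩ := (Finsupp.mem_span_image_iff_linearCombination F).1 h
    have hl0 : ∀ j, j ∉ S → l j = 0 := (Finsupp.mem_supported' F l).1 hl
    have hsum : M.mulVec l = M.col i := by
      rw [← hli, Finsupp.linearCombination_apply, Finsupp.sum_fintype _ _ (by simp),
        Matrix.mulVec_eq_sum]
      simp [Matrix.col]
    refine ⟨(l : ι → F) - Pi.single i 1, ?_, ?_, ?_⟩
    · rw [Matrix.mulVec_sub, hsum, Matrix.mulVec_single_one, sub_self]
    · simp [hl0 i hi]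
    · intro j hj hjS
      simp [hl0 j hjS, hj]
  · rintro ⟨y, hy, hyi, hy0⟩
    rw [Matrix.mulVec_eq_sum, ← Finset.add_sum_erase _ _ (Finset.mem_univ i)] at hy
    have hmem : y i • M.col i ∈ Submodule.span F (M.col '' S) := by
      have h : y i • M.col i = -∑ j ∈ Finset.univ.erase i, y j • M.col j := by
        rw [eq_neg_iff_add_eq_zero, ← hy]
        simp [Matrix.col]
      rw [h]
      refine neg_mem (sum_mem fun j hj => ?_)
      by_cases hjS : j ∈ S
      · exact Submodule.smul_mem _ _ (Submodule.subset_span ⟨j, hjS, rfl⟩)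
      · simp [hy0 j (Finset.ne_of_mem_erase hj) hjS]
    exact (Submodule.smul_mem_iff _ hyi).1 hmem

/-- Columns indexed injectively by `f` are independent iff no nonzero kernel vector is supported on
the range of `f`. -/
lemma Matrix.linearIndependent_col_comp_iff (M : Matrix m ι F) {κ : Type*} [Fintype κ]
    {f : κ → ι} (hf : Function.Injective f) :
    LinearIndependent F (fun k => M.col (f k)) ↔
      ∀ y : ι → F, M.mulVec y = 0 → (∀ j, j ∉ Set.range f → y j = 0) → y = 0 := by
  classical
  have key : ∀ y : ι → F, (∀ j, j ∉ Set.range f → y j = 0) →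
      M.mulVec y = ∑ k, y (f k) • M.col (f k) := by
    intro y hy
    rw [Matrix.mulVec_eq_sum]
    symm
    refine Finset.sum_of_injOn f hf.injOn (by simp) (fun j _ hj => ?_)
      (fun k _ => by simp [Matrix.col])
    simp [hy j (by simpa using hj)]
  rw [Fintype.linearIndependent_iff]
  constructor
  · intro h y hy hy0
    rw [key y hy0] at hy
    funext j
    by_cases hj : j ∈ Set.range f
    · obtain ⟨k, rfl⟩ := hj
      exact h (fun k => y (f k)) hy k
    · exact hy0 j hj
  · intro h g hg k
    have hy0 : ∀ j, j ∉ Set.range f → Function.extend f g 0 j = 0 := fun j hj => by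
      rw [Function.extend_apply' _ _ _ hj]; rfl
    have := h (Function.extend f g 0)
      (by rw [key _ hy0]; simpa [hf.extend_apply] using hg) hy0
    simpa [hf.extend_apply] using congrFun this (f k)

/-- If the rows of `M` span the annihilator of `W`, then the kernel of `M` is contained in `W`. -/
lemma Matrix.mem_of_mulVec_eq_zero_of_span_rows (M : Matrix m ι F) (W : Submodule F (ι → F))
    (hM : ∀ v : ι → F, (∀ w ∈ W, v ⬝ᵥ w = 0) → v ∈ Submodule.span F (Set.range M))
    {y : ι → F} (hy : M.mulVec y = 0) : y ∈ W := by
  classical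
  by_contra hyW
  obtain ⟨f, hfy, hf⟩ := Submodule.exists_le_ker_of_notMem hyW
  have hdot : ∀ w, (fun j => f (Pi.single j 1)) ⬝ᵥ w = f w := by
    intro w
    conv_rhs => rw [pi_eq_sum_univ' w]
    simp [dotProduct, mul_comm]
  have hspan := hM (fun j => f (Pi.single j 1)) fun w hw => (hdot w).trans (hf hw)
  have hzero : ∀ v ∈ Submodule.span F (Set.range M), v ⬝ᵥ y = 0 := by
    intro v hv
    induction hv using Submodule.span_induction with
    | mem v hv => obtain ⟨r, rfl⟩ := hv; exact congrFun hy r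
    | zero => simp
    | add u v _ _ hu hv => simp [add_dotProduct, hu, hv]
    | smul t v _ hv => simp [smul_dotProduct, hv]
  exact hfy ((hdot y).symm.trans (hzero _ hspan))

end Columns

/-- A column of a parity-check matrix of the punctured code is outside the span of a set of other
columns iff no codeword is nonzero there while vanishing on the remaining kept coordinates. -/
lemma col_notMem_span_iff_of_dual_punctured {F R m : Type*} [Field F] {n k : ℕ} (hk : k ≤ n)
    (H : Matrix m (Fin n) F) (M : Matrix R (Fin k) F)
    (hM : (Submodule.span F (Set.range M) : Set (Fin k → F)) =
      {v | ∀ c : Fin n → F, H.mulVec c = 0 → ∑ j, v j * c (Fin.castLE hk j) = 0})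
    {i : Fin k} {S : Set (Fin k)} (hi : i ∉ S) :
    M.col i ∉ Submodule.span F (M.col '' S) ↔
      ∀ c : Fin n → F, H.mulVec c = 0 →
        (∀ j : Fin k, j ≠ i → j ∉ S → c (Fin.castLE hk j) = 0) → c (Fin.castLE hk i) = 0 := by
  rw [M.col_mem_span_image_iff hi]
  constructor
  · intro h c hc hc0
    by_contra hci
    refine h ⟨fun j => c (Fin.castLE hk j), ?_, hci, hc0⟩
    funext r
    have : M r ∈ (Submodule.span F (Set.range M) : Set (Fin k → F)) :=
      Submodule.subset_span ⟨r, rfl⟩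
    rw [hM] at this
    exact this c hc
  · rintro h ⟨y, hy, hyi, hy0⟩
    have hyW := M.mem_of_mulVec_eq_zero_of_span_rows
      ((LinearMap.ker H.mulVecLin).map (LinearMap.funLeft F F (Fin.castLE hk)))
      (fun v hv => by
        rw [← SetLike.mem_coe, hM]
        exact fun c hc => hv _ ⟨c, hc, rfl⟩) hy
    obtain ⟨c, hc, rfl⟩ := hyW
    exact hyi (h c hc hy0)

/-- By linearity, delay recoverability only needs to be tested against the zero codeword. -/
lemma delayRecoverable_iff {F : Type*} [Field F] {n : ℕ} (a b τ : ℕ)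
    (C : Submodule F (Fin n → F)) :
    DelayRecoverable a b τ C ↔
      (∀ (ℓ : Fin n), ∀ c ∈ C, (∀ j : Fin n, (j : ℕ) < ℓ → c j = 0) →
        (∀ j : Fin n, (ℓ : ℕ) + b ≤ j → (j : ℕ) ≤ ℓ + τ → c j = 0) → c ℓ = 0) ∧
      (∀ (ℓ : Fin n) (E : Finset (Fin n)), ℓ ∈ E →
        (∀ j ∈ E, (ℓ : ℕ) ≤ j ∧ (j : ℕ) ≤ ℓ + τ) → E.card ≤ a →
        ∀ c ∈ C, (∀ j : Fin n, (j : ℕ) < ℓ → c j = 0) →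
          (∀ j : Fin n, (ℓ : ℕ) < j → (j : ℕ) ≤ ℓ + τ → j ∉ E → c j = 0) → c ℓ = 0) := by
  unfold DelayRecoverable
  refine and_congr ⟨fun h ℓ c hc h1 h2 => h ℓ c 0 hc C.zero_mem h1 h2,
      fun h ℓ c c' hc hc' h1 h2 => ?_⟩
    ⟨fun h ℓ E hℓ hE ha c hc h1 h2 => h ℓ E hℓ hE ha c 0 hc C.zero_mem h1 h2,
      fun h ℓ E hℓ hE ha c c' hc hc' h1 h2 => ?_⟩
  · exact sub_eq_zero.1 (h ℓ (c - c') (C.sub_mem hc hc')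
      (fun j hj => sub_eq_zero.2 (h1 j hj)) fun j hj hj' => sub_eq_zero.2 (h2 j hj hj'))
  · exact sub_eq_zero.1 (h ℓ E hℓ hE ha (c - c') (C.sub_mem hc hc')
      (fun j hj => sub_eq_zero.2 (h1 j hj)) fun j hj hj' hjE => sub_eq_zero.2 (h2 j hj hj' hjE))

/-- A vector vanishes if each coordinate vanishes whenever all earlier ones do. -/
lemma eq_zero_of_forall_lt_imp {F : Type*} [Zero F] {n : ℕ} {c : Fin n → F}
    (h : ∀ ℓ : Fin n, (∀ j : Fin n, (j : ℕ) < ℓ → c j = 0) → c ℓ = 0) : c = 0 := by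
  funext ℓ
  induction ℓ using WellFoundedLT.induction with
  | ind ℓ ih => exact h ℓ fun j hj => ih j hj

/-- Let `1 ≤ a ≤ b ≤ τ`, `n = τ + b - a + 1`, `δ = b - a`, let `H`
be a `b × n` parity-check matrix with kernel code `C`, and for each `ℓ < δ` let
`Hl ℓ` be a matrix whose rows span the dual code of the restriction of `C` to the
coordinates `{0, …, ℓ+τ}` (a shortened parity-check matrix).  Then `C` is
`(a,b,τ)`-delay-recoverable if and only if conditions B1, B2, R1, R2 hold:
B1: for `ℓ < δ`, column `ℓ` of `Hl ℓ` is outside the span of its columns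
`ℓ+1, …, ℓ+b-1`;
B2: for `δ ≤ ℓ ≤ n - b`, columns `ℓ, …, ℓ+b-1` of `H` are linearly independent;
R1: for `ℓ < δ`, column `ℓ` of `Hl ℓ` is outside the span of any `a-1` of its
columns drawn from `ℓ+1, …, ℓ+τ`;
R2: any `a` columns of `H` drawn from `δ, …, n-1` are linearly independent. -/
theorem statement16 (a b τ : ℕ) (ha : 1 ≤ a) (hab : a ≤ b) (hbτ : b ≤ τ)
    {F : Type*} [Field F] [Fintype F]
    (H : Matrix (Fin b) (Fin (τ + b - a + 1)) F)
    (ρ : ℕ → ℕ)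
    (Hl : (ℓ : ℕ) → Matrix (Fin (ρ ℓ)) (Fin (ℓ + τ + 1)) F)
    (hHl : ∀ ℓ : ℕ, (hℓ : ℓ < b - a) →
      (Submodule.span F (Set.range (Hl ℓ)) : Set (Fin (ℓ + τ + 1) → F)) =
        {v | ∀ c : Fin (τ + b - a + 1) → F, H.mulVec c = 0 →
          ∑ j : Fin (ℓ + τ + 1), v j * c (Fin.castLE (by omega) j) = 0}) :
    DelayRecoverable a b τ (LinearMap.ker H.mulVecLin) ↔
      ((∀ ℓ : ℕ, (hℓ : ℓ < b - a) →
          (fun r => Hl ℓ r ⟨ℓ, by omega⟩) ∉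
            Submodule.span F {v : Fin (ρ ℓ) → F |
              ∃ j : Fin (ℓ + τ + 1), ℓ + 1 ≤ (j : ℕ) ∧ (j : ℕ) ≤ ℓ + b - 1 ∧
                v = fun r => Hl ℓ r j}) ∧
       (∀ ℓ : ℕ, (hℓ1 : b - a ≤ ℓ) → (hℓ2 : ℓ ≤ (τ + b - a + 1) - b) →
          LinearIndependent F
            (fun i : Fin b => fun r => H r ⟨ℓ + (i : ℕ), by have := i.isLt; omega⟩)) ∧
       (∀ ℓ : ℕ, (hℓ : ℓ < b - a) → ∀ S : Finset (Fin (ℓ + τ + 1)),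
          (∀ j ∈ S, ℓ + 1 ≤ (j : ℕ) ∧ (j : ℕ) ≤ ℓ + τ) → S.card = a - 1 →
          (fun r => Hl ℓ r ⟨ℓ, by omega⟩) ∉
            Submodule.span F
              ((fun j : Fin (ℓ + τ + 1) => fun r => Hl ℓ r j) '' ↑S)) ∧
       (∀ S : Finset (Fin (τ + b - a + 1)),
          (∀ j ∈ S, b - a ≤ (j : ℕ)) → S.card = a →
          LinearIndependent F (fun j : S => fun r => H r j.1))) := by
  have hburst : ∀ ℓ : ℕ, (hℓ : ℓ < b - a) →
      ((fun r => Hl ℓ r ⟨ℓ, by omega⟩) ∉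
        Submodule.span F {v : Fin (ρ ℓ) → F |
          ∃ j : Fin (ℓ + τ + 1), ℓ + 1 ≤ (j : ℕ) ∧ (j : ℕ) ≤ ℓ + b - 1 ∧
            v = fun r => Hl ℓ r j} ↔
      ∀ c ∈ LinearMap.ker H.mulVecLin,
        (∀ j : Fin (τ + b - a + 1), (j : ℕ) < ℓ → c j = 0) →
        (∀ j : Fin (τ + b - a + 1), ℓ + b ≤ j → (j : ℕ) ≤ ℓ + τ → c j = 0) →
        c ⟨ℓ, by omega⟩ = 0) := by
    intro ℓ hℓ
    have hset : {v : Fin (ρ ℓ) → F | ∃ j : Fin (ℓ + τ + 1), ℓ + 1 ≤ (j : ℕ) ∧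
        (j : ℕ) ≤ ℓ + b - 1 ∧ v = fun r => Hl ℓ r j} =
        (Hl ℓ).col '' {j | ℓ + 1 ≤ (j : ℕ) ∧ (j : ℕ) ≤ ℓ + b - 1} := by
      ext v
      simp only [Set.mem_ofPred_eq, Set.mem_image, and_assoc]
      exact exists_congr fun j => and_congr_right fun _ => and_congr_right fun _ => eq_comm
    rw [hset]
    refine (col_notMem_span_iff_of_dual_punctured (by omega) H (Hl ℓ) (hHl ℓ hℓ)
      (i := ⟨ℓ, by omega⟩) (by simp)).trans ?_
    refine forall₂_congr fun c _ => ⟨fun h h1 h2 => h fun j hj hjS => ?_,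
      fun h h0 => h (fun j hj => ?_) fun j hj hj' => ?_⟩
    · simp only [ne_eq, Fin.ext_iff, Set.mem_ofPred_eq] at hj hjS
      rcases lt_or_ge (j : ℕ) ℓ with hlt | hge
      · exact h1 _ hlt
      · exact h2 _ (by simp only [Fin.val_castLE]; omega) (by simp only [Fin.val_castLE]; omega)
    · exact h0 ⟨j, by omega⟩ (by simp only [ne_eq, Fin.mk.injEq]; omega)
        (by simp only [Set.mem_ofPred_eq]; omega)
    · exact h0 ⟨j, by omega⟩ (by simp only [ne_eq, Fin.mk.injEq]; omega)
        (by simp only [Set.mem_ofPred_eq]; omega)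
  have hrandom : ∀ ℓ : ℕ, (hℓ : ℓ < b - a) → ∀ S : Finset (Fin (ℓ + τ + 1)),
      (∀ j ∈ S, ℓ + 1 ≤ (j : ℕ) ∧ (j : ℕ) ≤ ℓ + τ) →
      ((fun r => Hl ℓ r ⟨ℓ, by omega⟩) ∉
        Submodule.span F ((fun j : Fin (ℓ + τ + 1) => fun r => Hl ℓ r j) '' ↑S) ↔
      ∀ c ∈ LinearMap.ker H.mulVecLin,
        (∀ j : Fin (ℓ + τ + 1), (j : ℕ) ≠ ℓ → j ∉ S → c (Fin.castLE (by omega) j) = 0) →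
        c ⟨ℓ, by omega⟩ = 0) := by
    intro ℓ hℓ S hS
    refine (col_notMem_span_iff_of_dual_punctured (by omega) H (Hl ℓ) (hHl ℓ hℓ)
      (i := ⟨ℓ, by omega⟩) (S := ↑S) (fun h => ?_)).trans ?_
    · have := hS _ (Finset.mem_coe.1 h)
      simp at this
    · simp only [ne_eq, Fin.ext_iff, Finset.mem_coe]
      rfl
  have hwindow : ∀ ℓ : ℕ, (hℓ : ℓ ≤ (τ + b - a + 1) - b) →
      (LinearIndependent F
        (fun i : Fin b => fun r => H r ⟨ℓ + (i : ℕ), by have := i.isLt; omega⟩) ↔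
      ∀ c ∈ LinearMap.ker H.mulVecLin,
        (∀ j : Fin (τ + b - a + 1), ¬ (ℓ ≤ (j : ℕ) ∧ (j : ℕ) < ℓ + b) → c j = 0) → c = 0) := by
    intro ℓ hℓ
    let f : Fin b → Fin (τ + b - a + 1) := fun i => ⟨ℓ + (i : ℕ), by have := i.isLt; omega⟩
    have hf : Function.Injective f := fun i i' h => by
      simpa [f, Fin.ext_iff] using h
    have hrange : ∀ j, j ∈ Set.range f ↔ ℓ ≤ (j : ℕ) ∧ (j : ℕ) < ℓ + b := by
      intro j
      constructor
      · rintro ⟨i, rfl⟩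
        have := i.isLt
        simp only [f]
        omega
      · intro hj
        exact ⟨⟨j - ℓ, by omega⟩, Fin.ext (by simp only [f]; omega)⟩
    refine (H.linearIndependent_col_comp_iff hf).trans ?_
    simp only [hrange]
    rfl
  have hsubset : ∀ S : Finset (Fin (τ + b - a + 1)),
      (LinearIndependent F (fun j : S => fun r => H r j.1) ↔
      ∀ c ∈ LinearMap.ker H.mulVecLin, (∀ j, j ∉ S → c j = 0) → c = 0) := by
    intro S
    refine (H.linearIndependent_col_comp_iff (f := ((↑) : S → Fin (τ + b - a + 1)))
      Subtype.val_injective).trans ?_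
    simp only [Subtype.range_coe_subtype, Set.mem_ofPred_eq]
    rfl
  rw [delayRecoverable_iff]
  constructor
  · rintro ⟨hB, hR⟩
    refine ⟨fun ℓ hℓ => (hburst ℓ hℓ).2 fun c hc => hB ⟨ℓ, by omega⟩ c hc,
      fun ℓ hℓ1 hℓ2 => (hwindow ℓ hℓ2).2 fun c hc hc0 => ?_,
      fun ℓ hℓ S hS hcard => (hrandom ℓ hℓ S hS).2 fun c hc hc0 => ?_,
      fun S hS hcard => (hsubset S).2 fun c hc hc0 => ?_⟩
    · refine eq_zero_of_forall_lt_imp fun k hk => ?_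
      by_cases hkℓ : ℓ ≤ (k : ℕ)
      · exact hB k c hc hk fun j hj _ => hc0 j (by omega)
      · exact hc0 k (by omega)
    · have hn : ℓ + τ + 1 ≤ τ + b - a + 1 := by omega
      refine hR ⟨ℓ, by omega⟩
        (insert ⟨ℓ, by omega⟩ (S.map (Fin.castLEEmb hn))) (Finset.mem_insert_self _ _)
        ?_ ?_ c hc ?_ ?_
      · intro j hj
        rcases Finset.mem_insert.1 hj with rfl | hj
        · simp
        · obtain ⟨i, hi, rfl⟩ := Finset.mem_map.1 hj
          have := hS i hi
          simp only [Fin.castLEEmb_apply, Fin.val_castLE]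
          omega
      · refine (Finset.card_insert_le _ _).trans ?_
        rw [Finset.card_map]
        omega
      · intro j hj
        exact hc0 ⟨j, by simp only at hj; omega⟩ (by simp only at hj ⊢; omega) fun h => by
          have := hS _ h
          simp only at hj this
          omega
      · intro j hj hj' hjE
        refine hc0 ⟨j, by simp only at hj'; omega⟩ (by simp only at hj ⊢; omega) fun h => hjE ?_
        exact Finset.mem_insert_of_mem (Finset.mem_map.2 ⟨_, h, rfl⟩)
    · refine eq_zero_of_forall_lt_imp fun k hk => ?_
      by_cases hkS : k ∈ S
      · refine hR k (S.filter fun j => k ≤ j) (by simp [hkS]) ?_ ?_ c hc hk ?_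
        · intro j hj
          obtain ⟨-, hj⟩ := Finset.mem_filter.1 hj
          have := hS k hkS
          exact ⟨hj, by omega⟩
        · exact (Finset.card_filter_le _ _).trans hcard.le
        · intro j hj _ hjE
          exact hc0 j fun hjS => hjE (Finset.mem_filter.2 ⟨hjS, hj.le⟩)
      · exact hc0 k hkS
  · rintro ⟨hB1, hB2, hR1, hR2⟩
    refine ⟨fun ℓ c hc h1 h2 => ?_, fun ℓ E hℓE hE hcard c hc h1 h2 => ?_⟩
    · by_cases hℓ : (ℓ : ℕ) < b - a
      · exact (hburst ℓ hℓ).1 (hB1 ℓ hℓ) c hc h1 h2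
      · have hmin := (hwindow (min ℓ (τ + b - a + 1 - b)) (by omega)).1
          (hB2 _ (by omega) (by omega)) c hc fun j hj => ?_
        · exact congrFun hmin ℓ
        · rcases lt_or_ge (j : ℕ) ℓ with hlt | hge
          · exact h1 j hlt
          · exact h2 j (by omega) (by omega)
    · by_cases hℓ : (ℓ : ℕ) < b - a
      · let T : Finset (Fin (ℓ + τ + 1)) :=
          Finset.univ.filter fun j => Fin.castLE (by omega) j ∈ E.erase ℓ
        let U : Finset (Fin (ℓ + τ + 1)) := Finset.Ioc ⟨ℓ, by omega⟩ (Fin.last _)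
        have hTU : T ⊆ U := by
          intro j hj
          obtain ⟨hjℓ, hjE⟩ := Finset.mem_erase.1 (Finset.mem_filter.1 hj).2
          have := hE _ hjE
          simp only [ne_eq, Fin.ext_iff, Fin.val_castLE] at hjℓ this
          refine Finset.mem_Ioc.2 ⟨Fin.lt_def.2 ?_, Fin.le_last j⟩
          simp only
          omega
        have hT : T.card ≤ a - 1 := by
          have : T.card ≤ (E.erase ℓ).card :=
            Finset.card_le_card_of_injOn (Fin.castLE (by omega))
              (fun j hj => (Finset.mem_filter.1 hj).2) (Fin.castLE_injective _).injOn
          rw [Finset.card_erase_of_mem hℓE] at this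
          omega
        obtain ⟨S, hTS, hSU, hS⟩ := Finset.exists_subsuperset_card_eq hTU hT (by
          simp only [U, Fin.card_Ioc, Fin.val_last]; omega)
        have hS' : ∀ j ∈ S, (ℓ : ℕ) + 1 ≤ (j : ℕ) ∧ (j : ℕ) ≤ ℓ + τ := by
          intro j hj
          have := (Finset.mem_Ioc.1 (hSU hj)).1
          rw [Fin.lt_def] at this
          simp only at this
          omega
        refine (hrandom ℓ hℓ S hS').1 (hR1 ℓ hℓ S hS' hS) c hc fun j hj hjS => ?_
        rcases lt_or_ge (j : ℕ) ℓ with hlt | hge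
        · exact h1 _ hlt
        · refine h2 _ (by simp only [Fin.val_castLE]; omega)
            (by simp only [Fin.val_castLE]; omega) fun hjE => hjS (hTS ?_)
          refine Finset.mem_filter.2 ⟨Finset.mem_univ _, Finset.mem_erase.2 ⟨?_, hjE⟩⟩
          simpa [Fin.ext_iff] using hj
      · obtain ⟨S, hES, hSU, hS⟩ := Finset.exists_subsuperset_card_eq
          (s := E) (t := Finset.Ici (⟨b - a, by omega⟩ : Fin (τ + b - a + 1))) (n := a)
          (fun j hj => by
            have := hE j hj
            exact Finset.mem_Ici.2 (Fin.le_def.2 (by simp only; omega)))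
          hcard (by simp only [Fin.card_Ici]; omega)
        refine congrFun ((hsubset S).1 (hR2 S (fun j hj => ?_) hS) c hc fun j hj => ?_) ℓ
        · exact Fin.le_def.1 (Finset.mem_Ici.1 (hSU hj))
        · rcases lt_trichotomy (j : ℕ) ℓ with hlt | heq | hgt
          · exact h1 j hlt
          · exact absurd (hES (Fin.ext heq ▸ hℓE)) hj
          · exact h2 j hgt (by omega) fun hjE => hj (hES hjE)
end
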